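/- Let a < b be real numbers and let f : [a, b] → ℝ be continuous. Suppose that for every t₀ ∈ (a, b] there exists ε > 0 such that f(t) > f(t₀) for all t ∈ (t₀ − ε, t₀) ∩ [a, b] (f is locally strictly decreasing from the left at every point). Then f is strictly decreasing on [a, b]. -/

import Mathlib

theorem strictAnti_of_locally_strictly_decreasing_from_left
    (a b : ℝ) (hab : a < b) (f : ℝ → ℝ) (hf : ContinuousOn f (Set.Icc a b))
    (h : ∀ t₀ ∈ Set.Ioc a b, ∃ ε > 0,
      ∀ t ∈ Set.Ioo (t₀ - ε) t₀ ∩ Set.Icc a b, f t > f t₀) :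
    StrictAntiOn f (Set.Icc a b) := by
  intro x hx y hy hxy
  have not_max : ∀ c ∈ Set.Ioc x y, ∃ t ∈ Set.Icc x y, f c < f t := by
    intro c hc
    obtain ⟨ε, hε, hleft⟩ := h c ⟨hx.1.trans_lt hc.1, hc.2.trans hy.2⟩
    obtain ⟨t, ht, htc⟩ := exists_between (max_lt hc.1 (sub_lt_self c hε))
    have hxt : x < t := (le_max_left _ _).trans_lt ht
    have hty : t ≤ y := htc.le.trans hc.2
    exact ⟨t, ⟨hxt.le, hty⟩, hleft t
      ⟨⟨(le_max_right _ _).trans_lt ht, htc⟩, hx.1.trans hxt.le, hty.trans hy.2⟩⟩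
  obtain ⟨c, hc, hmax⟩ := isCompact_Icc.exists_isMaxOn (Set.nonempty_Icc.2 hxy.le)
    (hf.mono (Set.Icc_subset_Icc hx.1 hy.2))
  rw [isMaxOn_iff] at hmax
  rcases hc.1.eq_or_lt with rfl | hxc
  · obtain ⟨t, ht, hyt⟩ := not_max y ⟨hxy, le_rfl⟩
    exact hyt.trans_le (hmax t ht)
  · obtain ⟨t, ht, hct⟩ := not_max c ⟨hxc, hc.2⟩
    exact absurd (hmax t ht) hct.not_ge
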